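/- For any univalent map f : 𝔻 → ℂ and any ζ ∈ 𝔻, one has |((1−|ζ|²)/2)·(f''(ζ)/f'(ζ)) − ζ̄| ≤ 2, and (1−|ζ|²)|f'(ζ)| ≤ 4·dist(f(ζ), ∂f(𝔻)). -/

import Mathlib

open Complex Metric Set
open MeasureTheory

lemma exists_sq_inv (p : ℂ → ℂ) (hp : DifferentiableOn ℂ p (ball 0 1))
    (h0 : ∀ z ∈ ball (0:ℂ) 1, p z ≠ 0) (h1 : p 0 = 1) :
    ∃ s : ℂ → ℂ, DifferentiableOn ℂ s (ball 0 1) ∧ s 0 = 1 ∧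
      ∀ z ∈ ball (0:ℂ) 1, s z ^ 2 * p z = 1 := by
  have hd : DifferentiableOn ℂ (fun z => deriv p z / p z) (ball 0 1) :=
    (hp.deriv isOpen_ball).div hp h0
  obtain ⟨L, hL0, hL⟩ := hd.isExactOn_ball.with_val_at 0 0
  have hLd : DifferentiableOn ℂ L (ball 0 1) := fun z hz =>
    (hL z hz).differentiableAt.differentiableWithinAt
  refine ⟨fun z => exp (-L z / 2), by fun_prop, by simp [hL0], ?_⟩
  have key : ∀ z ∈ ball (0:ℂ) 1, exp (-L z) * p z = exp (-L 0) * p 0 := by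
    intro z hz
    refine isOpen_ball.is_const_of_deriv_eq_zero (f := fun z => exp (-L z) * p z)
      (convex_ball (0:ℂ) 1).isPreconnected (by fun_prop) ?_ hz (by simp)
    intro w hw
    have h2 : HasDerivAt p (deriv p w) w :=
      (hp.differentiableAt (isOpen_ball.mem_nhds hw)).hasDerivAt
    have := ((hL w hw).neg.cexp.mul h2).deriv
    simp only [Pi.zero_apply]
    refine this.trans ?_
    have := h0 w hw
    field_simp
    simp
  intro z hz
  have := key z hz
  rw [hL0, h1] at this
  simp only [neg_zero, exp_zero, mul_one] at this
  rw [← this, ← exp_nat_mul]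
  congr 2
  push_cast; ring

lemma det_formula (L : ℂ →ₗ[ℝ] ℂ) :
    LinearMap.det L = (L 1).re * (L I).im - (L I).re * (L 1).im := by
  rw [← LinearMap.det_toMatrix Complex.basisOneI, Matrix.det_fin_two]
  simp [LinearMap.toMatrix_apply]

lemma det_mul_clm (a : ℂ) :
    ((ContinuousLinearMap.toSpanSingleton ℂ a).restrictScalars ℝ : ℂ →L[ℝ] ℂ).det = ‖a‖ ^ 2 := by
  rw [ContinuousLinearMap.det, det_formula, Complex.sq_norm, normSq_apply]
  simp

lemma volume_ellipse (c : ℂ) (hc : ‖c‖ < 1) (M : ℝ) (hM : 0 ≤ M) :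
    volume {w : ℂ | ‖w - c * (starRingEnd ℂ) w‖ ≤ M} =
      ENNReal.ofReal (Real.pi * M ^ 2 / (1 - ‖c‖ ^ 2)) := by
  let L : ℂ →ₗ[ℝ] ℂ := LinearMap.id - (LinearMap.mulLeft ℝ c).comp Complex.conjLIE.toLinearMap
  have hL : ∀ w, L w = w - c * (starRingEnd ℂ) w := fun w => by simp [L]
  have hd : LinearMap.det L = 1 - ‖c‖ ^ 2 := by
    rw [det_formula, hL, hL, Complex.sq_norm, normSq_apply]
    simp
    ring
  have hp : 0 < 1 - ‖c‖ ^ 2 := by nlinarith [norm_nonneg c]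
  have he : {w : ℂ | ‖w - c * (starRingEnd ℂ) w‖ ≤ M} = L ⁻¹' (closedBall 0 M) := by
    ext w; simp [hL]
  rw [he, Measure.addHaar_preimage_linearMap _ (by rw [hd]; exact hp.ne'), hd,
    Complex.volume_closedBall, abs_of_pos (by positivity), ← ENNReal.ofReal_pow hM]
  rw [show ((NNReal.pi : NNReal) : ENNReal) = ENNReal.ofReal Real.pi by
    rw [← NNReal.coe_real_pi, ENNReal.ofReal_coe_nnreal]]
  rw [← ENNReal.ofReal_mul (by positivity), ← ENNReal.ofReal_mul (by positivity)]
  congr 1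
  field_simp

lemma integral_annulus (H : ℂ → ℝ) (ρ R : ℝ) (hρ : 0 < ρ) (hR : ρ ≤ R)
    (hH : ContinuousOn H {z | ρ ≤ ‖z‖ ∧ ‖z‖ ≤ R}) :
    ∫ z in {z : ℂ | ρ ≤ ‖z‖ ∧ ‖z‖ ≤ R}, H z =
      ∫ r in ρ..R, r * ∫ θ in (0)..(2 * Real.pi), H (circleMap 0 r θ) := by
  have hm : MeasurableSet {z : ℂ | ρ ≤ ‖z‖ ∧ ‖z‖ ≤ R} := by
    apply IsClosed.measurableSet
    exact (isClosed_le continuous_const continuous_norm).inter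
      (isClosed_le continuous_norm continuous_const)
  have hs : ∀ p : ℝ × ℝ, Complex.polarCoord.symm p = circleMap 0 p.1 p.2 := by
    intro p
    rw [Complex.polarCoord_symm_apply, circleMap, exp_mul_I]
    simp
  rw [← integral_indicator hm, ← Complex.integral_comp_polarCoord_symm, polarCoord_target]
  have h1 : ∫ p in Ioi (0:ℝ) ×ˢ Ioo (-Real.pi) Real.pi,
      p.1 • indicator {z : ℂ | ρ ≤ ‖z‖ ∧ ‖z‖ ≤ R} H (Complex.polarCoord.symm p) =
      ∫ p in Icc ρ R ×ˢ Ioo (-Real.pi) Real.pi, p.1 * H (circleMap 0 p.1 p.2) := by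
    rw [← integral_indicator (measurableSet_Ioi.prod measurableSet_Ioo),
      ← integral_indicator (measurableSet_Icc.prod measurableSet_Ioo)]
    congr 1
    ext ⟨r, θ⟩
    simp only [hs, indicator, mem_prod, mem_Ioi, mem_Ioo, mem_Icc, mem_ofPred_eq, norm_circleMap_zero]
    by_cases h0 : 0 < r
    · rw [abs_of_pos h0]
      by_cases h2 : ρ ≤ r ∧ r ≤ R <;> simp [h0, h2]
    · have : ¬ ρ ≤ r := by linarith
      simp [h0, this]
  rw [h1]
  have hintg : IntegrableOn (fun p : ℝ × ℝ => p.1 * H (circleMap 0 p.1 p.2))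
      (Icc ρ R ×ˢ Ioo (-Real.pi) Real.pi) (volume.prod volume) := by
    have : IntegrableOn (fun p : ℝ × ℝ => p.1 * H (circleMap 0 p.1 p.2))
      (Icc ρ R ×ˢ Icc (-Real.pi) Real.pi) (volume.prod volume) := by
      apply ContinuousOn.integrableOn_compact (isCompact_Icc.prod isCompact_Icc)
      apply continuousOn_fst.mul
      apply hH.comp (t := {z : ℂ | ρ ≤ ‖z‖ ∧ ‖z‖ ≤ R})
      · unfold circleMap; fun_prop
      · rintro ⟨r, θ⟩ ⟨h, -⟩
        simp only [mem_Icc] at h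
        simp only [mem_ofPred_eq, norm_circleMap_zero, abs_of_pos (hρ.trans_le h.1)]
        exact h
    exact this.mono_set (prod_mono le_rfl Ioo_subset_Icc_self)
  rw [Measure.volume_eq_prod, setIntegral_prod _ hintg, intervalIntegral.integral_of_le hR,
    integral_Icc_eq_integral_Ioc]
  congr 1
  ext r
  rw [integral_const_mul, ← integral_Ioc_eq_integral_Ioo,
    ← intervalIntegral.integral_of_le (by linarith [Real.pi_pos])]
  congr 1
  have hp : Function.Periodic (fun θ => H (circleMap 0 r θ)) (2 * Real.pi) :=
    fun θ => by simp [periodic_circleMap 0 r θ]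
  have := hp.intervalIntegral_add_eq (-Real.pi) 0
  rw [zero_add] at this
  rw [← this]
  congr 1; ring

lemma integral_re_eq_zero (Φ : ℂ → ℂ) (r : ℝ) (hr : 0 < r) (hr1 : r < 1)
    (hΦ : DifferentiableOn ℂ Φ (ball 0 1)) (h0 : Φ 0 = 0) :
    ∫ θ in (0)..(2 * Real.pi), (Φ (circleMap 0 r θ)).re = 0 := by
  have hc : ContinuousOn Φ (closedBall 0 r) :=
    hΦ.continuousOn.mono (closedBall_subset_ball hr1)
  have hdc : DiffContOnCl ℂ Φ (ball 0 |r|) := by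
    rw [abs_of_pos hr]
    exact DifferentiableOn.diffContOnCl (by
      rw [closure_ball _ hr.ne']; exact hΦ.mono (closedBall_subset_ball hr1))
  have h := hdc.circleAverage
  rw [Real.circleAverage_def, h0] at h
  have h2 : ∫ θ in (0)..(2 * Real.pi), Φ (circleMap 0 r θ) = 0 := by
    simpa [Real.pi_ne_zero] using h
  have hi : IntervalIntegrable (fun θ => Φ (circleMap 0 r θ)) volume 0 (2 * Real.pi) := by
    apply Continuous.intervalIntegrable
    apply hc.comp_continuous (continuous_circleMap 0 r)
    intro θ; simp [abs_of_pos hr]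
  have := Complex.reCLM.intervalIntegral_comp_comm hi
  simp only [Complex.reCLM_apply] at this
  rw [this, h2]; rfl

lemma ellipse_mem (b z n : ℂ) (ρ C : ℝ) (hρ : 0 < ρ) (hz : ρ ≤ ‖z‖) (hz1 : ‖z‖ ≤ 1)
    (hn : ‖n‖ ≤ C) (hsm : 2 * (2 * C + ‖b‖ ^ 2) * ρ + 2 * ‖b‖ * ρ ≤ 1) :
    ‖(z⁻¹ + b * z + z ^ 2 * n) -
      (b * (ρ:ℂ) ^ 2) * (starRingEnd ℂ) (z⁻¹ + b * z + z ^ 2 * n)‖ ≤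
      1 / ρ + (2 * C + ‖b‖ ^ 2) * ρ ^ 2 := by
  set r := ‖z‖ with hr
  have hr0 : 0 < r := hρ.trans_le hz
  have hz0 : z ≠ 0 := norm_pos_iff.1 hr0
  have hC : 0 ≤ C := (norm_nonneg n).trans hn
  have hB : 0 ≤ ‖b‖ := norm_nonneg b
  have hzz : z * (starRingEnd ℂ) z = (r:ℂ) ^ 2 := by rw [mul_conj, normSq_eq_norm_sq]; simp [hr]
  have hrc : (r:ℂ) ≠ 0 := by exact_mod_cast hr0.ne'
  have hcz : (starRingEnd ℂ) z ≠ 0 := by simpa using hz0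
  have e1 : (z⁻¹ + b * z + z ^ 2 * n) -
      (b * (ρ:ℂ) ^ 2) * (starRingEnd ℂ) (z⁻¹ + b * z + z ^ 2 * n) =
      z⁻¹ + b * (((r ^ 2 - ρ ^ 2) / r ^ 2 : ℝ) * z) - b * (starRingEnd ℂ) b * (ρ:ℂ) ^ 2 * (starRingEnd ℂ) z
        + (z ^ 2 * n - (b * (ρ:ℂ) ^ 2) * (starRingEnd ℂ) (z ^ 2 * n)) := by
    have : (starRingEnd ℂ) (z⁻¹) = z / (r:ℂ) ^ 2 := by
      rw [map_inv₀]; field_simp; rw [← hzz]; ring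
    rw [map_add, map_add, this, map_mul]
    push_cast
    field_simp
    ring
  rw [e1]
  have hρn : ‖(ρ:ℂ)‖ = ρ := by simp [abs_of_pos hρ]
  have hbρ : ‖b‖ * ρ ^ 2 ≤ 1 := by
    have : ‖b‖ * ρ ≤ 1 := by nlinarith [mul_nonneg hC hρ.le, mul_nonneg (sq_nonneg ‖b‖) hρ.le, mul_nonneg hB hρ.le]
    nlinarith [mul_nonneg hB hρ.le]
  have n1 : ‖z⁻¹‖ = 1 / r := by rw [norm_inv, one_div]
  have n2 : ‖b * (((r ^ 2 - ρ ^ 2) / r ^ 2 : ℝ) * z)‖ = ‖b‖ * ((r ^ 2 - ρ ^ 2) / r) := by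
    rw [norm_mul, norm_mul, Complex.norm_of_nonneg, ← hr]
    · field_simp
    · apply div_nonneg _ (sq_nonneg r); nlinarith
  have n3 : ‖b * (starRingEnd ℂ) b * (ρ:ℂ) ^ 2 * (starRingEnd ℂ) z‖ ≤ ‖b‖ ^ 2 * r ^ 2 := by
    simp only [norm_mul, norm_pow, hρn, RCLike.norm_conj, ← hr]
    have : ρ ^ 2 * r ≤ r ^ 2 := by nlinarith
    nlinarith [mul_le_mul_of_nonneg_left this (sq_nonneg ‖b‖)]
  have n4 : ‖z ^ 2 * n - (b * (ρ:ℂ) ^ 2) * (starRingEnd ℂ) (z ^ 2 * n)‖ ≤ 2 * C * r ^ 2 := by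
    have h1 : ‖z ^ 2 * n‖ ≤ r ^ 2 * C := by
      rw [norm_mul, norm_pow, ← hr]; gcongr
    refine (norm_sub_le _ _).trans ?_
    rw [norm_mul _ ((starRingEnd ℂ) _), RCLike.norm_conj, norm_mul b, norm_pow, hρn]
    nlinarith [norm_nonneg (z ^ 2 * n)]
  refine (norm_add_le _ _).trans ?_
  refine (add_le_add (norm_sub_le _ _) le_rfl).trans ?_
  refine (add_le_add (add_le_add (norm_add_le _ _) le_rfl) le_rfl).trans ?_
  rw [n1, n2]
  set D := 2 * C + ‖b‖ ^ 2 with hD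
  have hD0 : 0 ≤ D := by positivity
  have : 1 / ρ + D * ρ ^ 2 - (1 / r + ‖b‖ * ((r ^ 2 - ρ ^ 2) / r) + D * r ^ 2) =
      (r - ρ) / (ρ * r) * (1 - D * ((r + ρ) * r * ρ) - ‖b‖ * ((r + ρ) * ρ)) := by
    field_simp; ring
  have h5 : 0 ≤ (r - ρ) / (ρ * r) * (1 - D * ((r + ρ) * r * ρ) - ‖b‖ * ((r + ρ) * ρ)) := by
    apply mul_nonneg (div_nonneg (by linarith) (by positivity))
    have a1 : (r + ρ) * ρ ≤ 2 * ρ := by nlinarith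
    have a2 : (r + ρ) * r * ρ ≤ 2 * ρ := by
      have : (r + ρ) * r ≤ 2 := by nlinarith
      nlinarith
    nlinarith [mul_le_mul_of_nonneg_left a1 hB, mul_le_mul_of_nonneg_left a2 hD0]
  nlinarith

lemma pointwise_lower (b z T : ℂ) (hz : z ≠ 0) :
    (‖z‖ ^ 4)⁻¹ + ‖b‖ ^ 2 + 2 * ((-z ^ 2 * ((‖z‖ ^ 4)⁻¹ : ℝ) + (starRingEnd ℂ) b) * T
      - b * z ^ 2 * ((‖z‖ ^ 4)⁻¹ : ℝ)).re ≤ ‖-(z ^ 2)⁻¹ + b + T‖ ^ 2 := by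
  have hzz : z * (starRingEnd ℂ) z = (‖z‖:ℂ) ^ 2 := by rw [mul_conj, normSq_eq_norm_sq]; simp
  have hrc : (‖z‖:ℂ) ≠ 0 := by simpa using hz
  have hcz : (starRingEnd ℂ) z ≠ 0 := by simpa using hz
  obtain ⟨u, hu⟩ : ∃ u, u = (z ^ 2)⁻¹ := ⟨_, rfl⟩
  have hcu : z ^ 2 * ((‖z‖ ^ 4)⁻¹ : ℝ) = (starRingEnd ℂ) u := by
    rw [hu, map_inv₀, map_pow]
    push_cast
    field_simp
    rw [show (‖z‖:ℂ) ^ 4 = ((‖z‖:ℂ) ^ 2) ^ 2 by ring, ← hzz]; ring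
  have hnu : (‖z‖ ^ 4)⁻¹ = normSq u := by
    rw [hu, normSq_eq_norm_sq, norm_inv, norm_pow]; ring
  rw [neg_mul, mul_assoc b, hcu, hnu, ← hu, Complex.sq_norm, Complex.sq_norm]
  have := normSq_nonneg T
  simp only [normSq_apply, add_re, sub_re, mul_re, neg_re, conj_re, conj_im, add_im, neg_im] at *
  nlinarith

lemma area_ineq (b : ℂ) (N : ℂ → ℂ) (hN : DifferentiableOn ℂ N (ball 0 1))
    (hinj : InjOn (fun z : ℂ => z⁻¹ + b * z + z ^ 2 * N z) (ball 0 1 \ {0}))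
    (ρ R C : ℝ) (hρ : 0 < ρ) (hρR : ρ ≤ R) (hR : R < 1) (hC : ∀ z, ‖z‖ ≤ R → ‖N z‖ ≤ C)
    (hsm : 2 * (2 * C + ‖b‖ ^ 2) * ρ + 2 * ‖b‖ * ρ ≤ 1) :
    (ρ ^ 2)⁻¹ - (R ^ 2)⁻¹ + ‖b‖ ^ 2 * (R ^ 2 - ρ ^ 2) ≤
      (1 / ρ + (2 * C + ‖b‖ ^ 2) * ρ ^ 2) ^ 2 / (1 - ‖b‖ ^ 2 * ρ ^ 4) := by
  set A : Set ℂ := {z : ℂ | ρ ≤ ‖z‖ ∧ ‖z‖ ≤ R} with hA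
  set g : ℂ → ℂ := fun z : ℂ => z⁻¹ + b * z + z ^ 2 * N z with hg
  set T : ℂ → ℂ := fun z => 2 * z * N z + z ^ 2 * deriv N z with hT
  have hC0 : 0 ≤ C := (norm_nonneg _).trans (hC 0 (by simp; linarith))
  have hB : 0 ≤ ‖b‖ := norm_nonneg b
  have hTd : DifferentiableOn ℂ T (ball 0 1) := by
    have := hN.deriv isOpen_ball
    fun_prop
  have hA0 : ∀ z ∈ A, z ≠ 0 := fun z hz => norm_pos_iff.1 (hρ.trans_le hz.1)
  have hA1 : A ⊆ ball 0 1 := fun z hz => by simpa using hz.2.trans_lt hR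
  have hsub : A ⊆ ball 0 1 \ {0} := fun z hz => ⟨hA1 hz, hA0 z hz⟩
  have hAc : IsCompact A := by
    apply (isCompact_closedBall (0:ℂ) R).of_isClosed_subset
    · exact (isClosed_le continuous_const continuous_norm).inter
        (isClosed_le continuous_norm continuous_const)
    · intro z hz; simpa using hz.2
  have hderiv : ∀ z ∈ A, HasDerivAt g (-(z ^ 2)⁻¹ + b + T z) z := by
    intro z hz
    have hNz := (hN.differentiableAt (isOpen_ball.mem_nhds (hA1 hz))).hasDerivAt
    have h := ((hasDerivAt_inv (hA0 z hz)).add ((hasDerivAt_id z).const_mul b)).add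
      ((hasDerivAt_pow 2 z).mul hNz)
    convert! h using 1
    simp [hT]
  have hTc : ContinuousOn T A := hTd.continuousOn.mono hA1
  -- area of the image
  have harea : volume (g '' A) = ENNReal.ofReal (∫ z in A, ‖-(z ^ 2)⁻¹ + b + T z‖ ^ 2) := by
    rw [← lintegral_abs_det_fderiv_eq_addHaar_image volume hAc.measurableSet
      (f' := fun z => (ContinuousLinearMap.toSpanSingleton ℂ
        (-(z ^ 2)⁻¹ + b + T z)).restrictScalars ℝ)
      (fun z hz => ((hderiv z hz).hasFDerivAt.restrictScalars ℝ).hasFDerivWithinAt)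
      (hinj.mono hsub)]
    rw [ofReal_integral_eq_lintegral_ofReal]
    · simp only [det_mul_clm, abs_pow, abs_norm]
    · apply ContinuousOn.integrableOn_compact hAc
      have : ContinuousOn (fun z : ℂ => (z ^ 2)⁻¹) A :=
        (continuousOn_id.pow 2).inv₀ fun z hz => pow_ne_zero 2 (hA0 z hz)
      fun_prop
    · exact Filter.Eventually.of_forall fun z => by positivity
  -- inclusion in the ellipse
  have hbρ : ‖b‖ * ρ ^ 2 < 1 := by
    have : ‖b‖ * ρ ≤ 1 := by
      nlinarith [mul_nonneg hC0 hρ.le, mul_nonneg (sq_nonneg ‖b‖) hρ.le, mul_nonneg hB hρ.le]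
    nlinarith [mul_nonneg hB hρ.le]
  have hcn : ‖b * (ρ:ℂ) ^ 2‖ = ‖b‖ * ρ ^ 2 := by simp
  have hincl : g '' A ⊆ {w : ℂ | ‖w - (b * (ρ:ℂ) ^ 2) * (starRingEnd ℂ) w‖ ≤
      1 / ρ + (2 * C + ‖b‖ ^ 2) * ρ ^ 2} := by
    rintro _ ⟨z, hz, rfl⟩
    exact ellipse_mem b z (N z) ρ C hρ hz.1 (hz.2.trans hR.le) (hC z hz.2) hsm
  have hM : 0 ≤ 1 / ρ + (2 * C + ‖b‖ ^ 2) * ρ ^ 2 := by positivity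
  have hle := measure_mono (μ := volume) hincl
  rw [volume_ellipse _ (by rwa [hcn]) _ hM, harea, hcn] at hle
  have hpos : 0 < 1 - (‖b‖ * ρ ^ 2) ^ 2 := by
    have : 0 ≤ ‖b‖ * ρ ^ 2 := by positivity
    nlinarith
  rw [ENNReal.ofReal_le_ofReal_iff (by positivity)] at hle
  -- lower bound
  set H : ℂ → ℝ := fun z => (‖z‖ ^ 4)⁻¹ + ‖b‖ ^ 2 +
    2 * ((-z ^ 2 * ((‖z‖ ^ 4)⁻¹ : ℝ) + (starRingEnd ℂ) b) * T z
      - b * z ^ 2 * ((‖z‖ ^ 4)⁻¹ : ℝ)).re with hH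
  have hHc : ContinuousOn H A := by
    have : ContinuousOn (fun z : ℂ => (‖z‖ ^ 4)⁻¹) A :=
      (continuous_norm.continuousOn.pow 4).inv₀ fun z hz => pow_ne_zero 4 (norm_ne_zero_iff.2 (hA0 z hz))
    fun_prop
  have hlow : ∫ z in A, H z ≤ ∫ z in A, ‖-(z ^ 2)⁻¹ + b + T z‖ ^ 2 := by
    apply setIntegral_mono_on (hHc.integrableOn_compact hAc) _ hAc.measurableSet
    · intro z hz; exact pointwise_lower b z (T z) (hA0 z hz)
    · apply ContinuousOn.integrableOn_compact hAc
      have : ContinuousOn (fun z : ℂ => (z ^ 2)⁻¹) A :=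
        (continuousOn_id.pow 2).inv₀ fun z hz => pow_ne_zero 2 (hA0 z hz)
      fun_prop
  have hval : ∫ z in A, H z =
      Real.pi * ((ρ ^ 2)⁻¹ - (R ^ 2)⁻¹ + ‖b‖ ^ 2 * (R ^ 2 - ρ ^ 2)) := by
    rw [hA, integral_annulus H ρ R hρ hρR hHc]
    have hinner : ∀ r ∈ uIcc ρ R, r * ∫ θ in (0)..(2 * Real.pi), H (circleMap 0 r θ) =
        2 * Real.pi * (r ^ (-3 : ℤ) + ‖b‖ ^ 2 * r) := by
      intro r hr
      rw [uIcc_of_le hρR] at hr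
      have hr0 : 0 < r := hρ.trans_le hr.1
      set Φ : ℂ → ℂ := fun z => (-z ^ 2 * ((r ^ 4)⁻¹ : ℝ) + (starRingEnd ℂ) b) * T z
        - b * z ^ 2 * ((r ^ 4)⁻¹ : ℝ) with hΦ
      have hΦd : DifferentiableOn ℂ Φ (ball 0 1) := by fun_prop
      have hz := integral_re_eq_zero Φ r hr0 (hr.2.trans_lt hR) hΦd (by simp [hΦ, hT])
      have hHe : ∀ θ, H (circleMap 0 r θ) = ((r ^ 4)⁻¹ + ‖b‖ ^ 2) + 2 * (Φ (circleMap 0 r θ)).re := by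
        intro θ
        simp only [hH, hΦ, norm_circleMap_zero, abs_of_pos hr0]
      have hi : IntervalIntegrable (fun θ => 2 * (Φ (circleMap 0 r θ)).re) volume 0 (2 * Real.pi) := by
        apply Continuous.intervalIntegrable
        apply Continuous.const_smul (c := (2:ℝ))
        apply Complex.continuous_re.comp
        apply hΦd.continuousOn.comp_continuous (continuous_circleMap 0 r)
        intro θ; simpa [abs_of_pos hr0] using hr.2.trans_lt hR
      simp only [hHe]
      rw [intervalIntegral.integral_add intervalIntegrable_const hi,
        intervalIntegral.integral_const_mul, hz, intervalIntegral.integral_const]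
      simp only [zpow_neg, smul_eq_mul]
      rw [show r ^ (3:ℤ) = r ^ 3 by norm_cast]
      field_simp
      ring
    rw [intervalIntegral.integral_congr hinner, intervalIntegral.integral_const_mul,
      intervalIntegral.integral_add, integral_zpow, intervalIntegral.integral_const_mul, integral_id]
    · norm_num
      ring
    · right; refine ⟨by norm_num, ?_⟩
      rw [uIcc_of_le hρR]; intro h; linarith [h.1]
    · apply intervalIntegral.intervalIntegrable_zpow
      right; rw [uIcc_of_le hρR]; intro h; linarith [h.1]
    · apply Continuous.intervalIntegrable; fun_prop
  have := hlow.trans hle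
  rw [hval, mul_div_assoc, show (‖b‖ * ρ ^ 2) ^ 2 = ‖b‖ ^ 2 * ρ ^ 4 by ring] at this
  exact le_of_mul_le_mul_left this Real.pi_pos

lemma area_thm (b : ℂ) (N : ℂ → ℂ) (hN : DifferentiableOn ℂ N (ball 0 1))
    (hinj : InjOn (fun z : ℂ => z⁻¹ + b * z + z ^ 2 * N z) (ball 0 1 \ {0})) : ‖b‖ ≤ 1 := by
  have hB : 0 ≤ ‖b‖ := norm_nonneg b
  have key : ∀ R : ℝ, 0 < R → R < 1 → ‖b‖ ^ 2 * R ^ 2 ≤ (R ^ 2)⁻¹ := by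
    intro R hR0 hR
    obtain ⟨C, hC⟩ := (isCompact_closedBall (0:ℂ) R).exists_bound_of_continuousOn
      (hN.continuousOn.mono (closedBall_subset_ball hR))
    have hC' : ∀ z : ℂ, ‖z‖ ≤ R → ‖N z‖ ≤ C := fun z hz => hC z (by simpa using hz)
    set D := 2 * C + ‖b‖ ^ 2 with hD
    have ev : ∀ᶠ ρ : ℝ in nhdsWithin 0 (Ioi 0),
        (-(R ^ 2)⁻¹ + ‖b‖ ^ 2 * (R ^ 2 - ρ ^ 2)) * (1 - ‖b‖ ^ 2 * ρ ^ 4) - ‖b‖ ^ 2 * ρ ^ 2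
          ≤ 2 * D * ρ + D ^ 2 * ρ ^ 4 := by
      have e1 : ∀ᶠ ρ : ℝ in nhdsWithin 0 (Ioi 0), 2 * D * ρ + 2 * ‖b‖ * ρ < 1 := by
        apply Filter.Eventually.filter_mono nhdsWithin_le_nhds
        have : Continuous (fun ρ : ℝ => 2 * D * ρ + 2 * ‖b‖ * ρ) := by fun_prop
        exact this.continuousAt.eventually_lt continuousAt_const (by simp)
      have e3 : ∀ᶠ ρ : ℝ in nhdsWithin 0 (Ioi 0), ‖b‖ ^ 2 * ρ ^ 4 < 1 := by
        apply Filter.Eventually.filter_mono nhdsWithin_le_nhds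
        have : Continuous (fun ρ : ℝ => ‖b‖ ^ 2 * ρ ^ 4) := by fun_prop
        exact this.continuousAt.eventually_lt continuousAt_const (by simp)
      have e2 : ∀ᶠ ρ : ℝ in nhdsWithin 0 (Ioi 0), ρ < R :=
        Filter.Eventually.filter_mono nhdsWithin_le_nhds (eventually_lt_nhds hR0)
      filter_upwards [e1, e2, e3, self_mem_nhdsWithin] with ρ h1 h2 h4 h3
      have h3 : 0 < ρ := h3
      have := area_ineq b N hN hinj ρ R C h3 h2.le hR hC' h1.le
      rw [le_div_iff₀ (by linarith)] at this
      have e : (1 / ρ + D * ρ ^ 2) ^ 2 = (ρ ^ 2)⁻¹ + 2 * D * ρ + D ^ 2 * ρ ^ 4 := by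
        field_simp; ring
      have e' : (ρ ^ 2)⁻¹ * (‖b‖ ^ 2 * ρ ^ 4) = ‖b‖ ^ 2 * ρ ^ 2 := by field_simp
      rw [e] at this
      nlinarith
    have l1 : Filter.Tendsto (fun ρ : ℝ => (-(R ^ 2)⁻¹ + ‖b‖ ^ 2 * (R ^ 2 - ρ ^ 2)) *
        (1 - ‖b‖ ^ 2 * ρ ^ 4) - ‖b‖ ^ 2 * ρ ^ 2) (nhdsWithin 0 (Ioi 0))
        (nhds (-(R ^ 2)⁻¹ + ‖b‖ ^ 2 * R ^ 2)) := by
      apply Filter.Tendsto.mono_left _ nhdsWithin_le_nhds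
      apply Continuous.tendsto' (by fun_prop)
      simp
    have l2 : Filter.Tendsto (fun ρ : ℝ => 2 * D * ρ + D ^ 2 * ρ ^ 4) (nhdsWithin 0 (Ioi 0))
        (nhds 0) := by
      apply Filter.Tendsto.mono_left _ nhdsWithin_le_nhds
      apply Continuous.tendsto' (by fun_prop)
      simp
    have := le_of_tendsto_of_tendsto l1 l2 ev
    linarith
  have ev : ∀ᶠ R : ℝ in nhdsWithin 1 (Iio 1), ‖b‖ ^ 2 * R ^ 2 ≤ (R ^ 2)⁻¹ := by
    have e2 : ∀ᶠ R : ℝ in nhdsWithin 1 (Iio 1), 0 < R :=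
      Filter.Eventually.filter_mono nhdsWithin_le_nhds (eventually_gt_nhds one_pos)
    filter_upwards [e2, self_mem_nhdsWithin] with R h1 h2
    exact key R h1 h2
  have l1 : Filter.Tendsto (fun R : ℝ => ‖b‖ ^ 2 * R ^ 2) (nhdsWithin 1 (Iio 1))
      (nhds (‖b‖ ^ 2)) := by
    apply Filter.Tendsto.mono_left _ nhdsWithin_le_nhds
    apply Continuous.tendsto' (by fun_prop)
    simp
  have l2 : Filter.Tendsto (fun R : ℝ => (R ^ 2)⁻¹) (nhdsWithin 1 (Iio 1)) (nhds 1) := by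
    apply Filter.Tendsto.mono_left _ nhdsWithin_le_nhds
    have : ContinuousAt (fun R : ℝ => (R ^ 2)⁻¹) 1 := by
      apply ContinuousAt.inv₀ (by fun_prop) (by norm_num)
    simpa using this.tendsto
  have := le_of_tendsto_of_tendsto l1 l2 ev
  nlinarith

lemma bieb_normalized (F : ℂ → ℂ) (hF : DifferentiableOn ℂ F (ball 0 1))
    (hinj : InjOn F (ball 0 1)) (h0 : F 0 = 0) (h1 : deriv F 0 = 1) :
    ‖deriv (deriv F) 0‖ ≤ 4 := by
  have hnh : ball (0:ℂ) 1 ∈ nhds 0 := ball_mem_nhds 0 one_pos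
  have hmem0 : (0:ℂ) ∈ ball (0:ℂ) 1 := by simp
  have hFp : ∀ z, F z = z * dslope F 0 z := fun z => by
    have := sub_smul_dslope F 0 z
    simp only [sub_zero, smul_eq_mul, h0] at this
    exact this.symm
  have hpd : DifferentiableOn ℂ (dslope F 0) (ball 0 1) := (differentiableOn_dslope hnh).2 hF
  have hpne : ∀ z ∈ ball (0:ℂ) 1, dslope F 0 z ≠ 0 := by
    intro z hz hp
    by_cases h : z = 0
    · rw [h, dslope_same, h1] at hp; exact one_ne_zero hp
    · apply h
      apply hinj hz hmem0
      rw [hFp z, hp, h0, mul_zero]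
  obtain ⟨s, hs, hs0, hsp⟩ := exists_sq_inv _ hpd hpne (by rw [dslope_same, h1])
  set b := deriv s 0 with hb
  have hmd : DifferentiableOn ℂ (dslope s 0) (ball 0 1) := (differentiableOn_dslope hnh).2 hs
  have hnd : DifferentiableOn ℂ (dslope (dslope s 0) 0) (ball 0 1) :=
    (differentiableOn_dslope hnh).2 hmd
  have hsm : ∀ z, s z = 1 + z * (b + z * dslope (dslope s 0) 0 z) := fun z => by
    have e1 := sub_smul_dslope s 0 z
    have e2 := sub_smul_dslope (dslope s 0) 0 z
    simp only [sub_zero, smul_eq_mul, hs0, dslope_same, ← hb] at e1 e2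
    rw [e2]
    linear_combination -e1
  have hsF : ∀ z ∈ ball (0:ℂ) 1, s z ^ 2 * F z = z := fun z hz => by
    rw [hFp z]; linear_combination z * hsp z hz
  have hsq : ∀ z ∈ ball (0:ℂ) 1, z ^ 2 ∈ ball (0:ℂ) 1 := by
    intro z hz
    simp only [mem_ball_zero_iff, norm_pow] at *
    exact pow_lt_one₀ (norm_nonneg z) hz two_ne_zero
  have hb1 : ‖b‖ ≤ 1 := by
    apply area_thm b (fun z => z * dslope (dslope s 0) 0 (z ^ 2))
    · exact differentiableOn_id.mul (hnd.comp (by fun_prop) hsq)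
    · have hg : ∀ z : ℂ, z ≠ 0 → z⁻¹ + b * z + z ^ 2 * (z * dslope (dslope s 0) 0 (z ^ 2)) =
          s (z ^ 2) / z := by
        intro z hz
        rw [hsm (z ^ 2)]; field_simp; ring
      rintro z ⟨hz, hz0⟩ w ⟨hw, hw0⟩ hzw
      simp only [mem_singleton_iff] at hz0 hw0
      simp only [hg z hz0, hg w hw0] at hzw
      have hsne : ∀ u ∈ ball (0:ℂ) 1, s u ≠ 0 := fun u hu hh => by
        have := hsp u hu; rw [hh] at this; simp at this
      have key : F (z ^ 2) = F (w ^ 2) := by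
        have ez := hsF _ (hsq z hz)
        have ew := hsF _ (hsq w hw)
        have h2 : s (z ^ 2) * w = s (w ^ 2) * z := by
          field_simp at hzw; linear_combination hzw
        have h3 : s (z ^ 2) ^ 2 * w ^ 2 = s (w ^ 2) ^ 2 * z ^ 2 := by
          linear_combination (s (z ^ 2) * w + s (w ^ 2) * z) * h2
        have n1 := hsne _ (hsq z hz)
        have n2 := hsne _ (hsq w hw)
        have : (s (z ^ 2) ^ 2 * s (w ^ 2) ^ 2) * (F (z ^ 2) - F (w ^ 2)) = 0 := by
          linear_combination s (w ^ 2) ^ 2 * ez - s (z ^ 2) ^ 2 * ew - h3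
        have := (mul_eq_zero.1 this).resolve_left (by positivity)
        exact sub_eq_zero.1 this
      have hzw2 := hinj (hsq z hz) (hsq w hw) key
      rw [hzw2] at hzw
      have n2 := hsne _ (hsq w hw)
      field_simp at hzw
      exact hzw.symm
  have hbe : deriv (deriv F) 0 = -(4 * b) := by
    have hs' := hs.deriv isOpen_ball
    have hF' := hF.deriv isOpen_ball
    have d1 : ∀ z ∈ ball (0:ℂ) 1, 2 * s z * deriv s z * F z + s z ^ 2 * deriv F z = 1 := by
      intro z hz
      have hn := isOpen_ball.mem_nhds hz
      have hd := ((hs.differentiableAt hn).hasDerivAt.pow 2).mul (hF.differentiableAt hn).hasDerivAt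
      have hid : HasDerivAt (fun z => z) 1 z := hasDerivAt_id z
      have he : (fun z => z) =ᶠ[nhds z] (s ^ 2 * F) := by
        filter_upwards [hn] with u hu
        exact (hsF u hu).symm
      have := hd.unique (hid.congr_of_eventuallyEq he.symm)
      simpa using this
    have hn := hnh
    have a1 := (hs.differentiableAt hn).hasDerivAt
    have a2 := (hs'.differentiableAt hn).hasDerivAt
    have a3 := (hF.differentiableAt hn).hasDerivAt
    have a4 := (hF'.differentiableAt hn).hasDerivAt
    have hd := (((a1.const_mul 2).mul a2).mul a3).add ((a1.pow 2).mul a4)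
    have hid : HasDerivAt (fun _ : ℂ => (1:ℂ)) 0 0 := hasDerivAt_const _ _
    have := hd.unique (hid.congr_of_eventuallyEq (by
      filter_upwards [hn] with u hu
      exact d1 u hu))
    simp [h0, hs0, h1, ← hb] at this
    linear_combination this
  rw [hbe, norm_neg, norm_mul]
  norm_num
  linarith

lemma bieb (F : ℂ → ℂ) (hF : DifferentiableOn ℂ F (ball 0 1))
    (hinj : InjOn F (ball 0 1)) (h1 : deriv F 0 ≠ 0) :
    ‖deriv (deriv F) 0 / deriv F 0‖ ≤ 4 := by
  have hd : deriv (fun z => (F z - F 0) / deriv F 0) = fun z => deriv F z / deriv F 0 := by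
    ext z; simp
  have := bieb_normalized (fun z => (F z - F 0) / deriv F 0) (by fun_prop)
    (fun z hz w hw h => hinj hz hw (by
      have := congrArg (fun u => u * deriv F 0 + F 0) h
      simpa [h1] using this)) (by simp) (by rw [hd]; simp [h1])
  rw [hd] at this
  simpa using this

lemma koebe (F : ℂ → ℂ) (hF : DifferentiableOn ℂ F (ball 0 1))
    (hinj : InjOn F (ball 0 1)) (h1 : deriv F 0 ≠ 0) (w : ℂ) (hw : ∀ z ∈ ball (0:ℂ) 1, F z ≠ w) :
    ‖deriv F 0‖ ≤ 4 * ‖w - F 0‖ := by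
  have hne : ∀ z ∈ ball (0:ℂ) 1, w - F z ≠ 0 := fun z hz h => hw z hz (sub_eq_zero.1 h).symm
  have hn0 : ball (0:ℂ) 1 ∈ nhds 0 := ball_mem_nhds 0 one_pos
  have hF' := hF.deriv isOpen_ball
  have d1 : ∀ z ∈ ball (0:ℂ) 1,
      deriv (fun z => (w - F z)⁻¹) z = deriv F z * ((w - F z)⁻¹) ^ 2 := by
    intro z hz
    have := (((hF.differentiableAt (isOpen_ball.mem_nhds hz)).hasDerivAt.const_sub w).inv
      (hne z hz)).deriv
    refine this.trans ?_
    have := hne z hz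
    field_simp
  have hG : DifferentiableOn ℂ (fun z => (w - F z)⁻¹) (ball 0 1) :=
    (hF.const_sub w).inv hne
  have hm : (0:ℂ) ∈ ball (0:ℂ) 1 := by simp
  have n0 := hne 0 hm
  have d2 : deriv (deriv (fun z => (w - F z)⁻¹)) 0 =
      deriv (deriv F) 0 * ((w - F 0)⁻¹) ^ 2 + 2 * deriv F 0 ^ 2 * ((w - F 0)⁻¹) ^ 3 := by
    have he : deriv (fun z => (w - F z)⁻¹) =ᶠ[nhds 0] fun z => deriv F z * ((w - F z)⁻¹) ^ 2 := by
      filter_upwards [hn0] with z hz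
      exact d1 z hz
    rw [he.deriv_eq]
    have g1 := (hG.differentiableAt hn0).hasDerivAt
    rw [d1 0 hm] at g1
    have := ((hF'.differentiableAt hn0).hasDerivAt.mul (g1.pow 2)).deriv
    refine this.trans ?_
    simp only [Pi.pow_apply, Nat.add_one_sub_one, pow_one, Nat.cast_ofNat]
    field_simp
  have hb := bieb (fun z => (w - F z)⁻¹) hG
    (fun z hz u hu h => hinj hz hu (by simpa using h)) (by
      rw [d1 0 hm]; exact mul_ne_zero h1 (pow_ne_zero 2 (inv_ne_zero n0)))
  rw [d2, d1 0 hm] at hb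
  have hb2 := bieb F hF hinj h1
  have e : (deriv (deriv F) 0 * ((w - F 0)⁻¹) ^ 2 + 2 * deriv F 0 ^ 2 * ((w - F 0)⁻¹) ^ 3) /
      (deriv F 0 * ((w - F 0)⁻¹) ^ 2) = deriv (deriv F) 0 / deriv F 0 +
      2 * (deriv F 0 / (w - F 0)) := by
    field_simp
  rw [e] at hb
  have h3 : ‖2 * (deriv F 0 / (w - F 0))‖ ≤ 8 := by
    have := norm_sub_le (deriv (deriv F) 0 / deriv F 0 +
      2 * (deriv F 0 / (w - F 0))) (deriv (deriv F) 0 / deriv F 0)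
    rw [add_sub_cancel_left] at this
    linarith
  rw [norm_mul, norm_div, Complex.norm_ofNat] at h3
  have : ‖deriv F 0‖ / ‖w - F 0‖ ≤ 4 := by linarith
  rwa [div_le_iff₀ (norm_pos_iff.2 n0)] at this

lemma image_open (f : ℂ → ℂ) (hf : DifferentiableOn ℂ f (ball 0 1))
    (hinj : InjOn f (ball 0 1)) : ∀ s ⊆ ball (0:ℂ) 1, IsOpen s → IsOpen (f '' s) := by
  have ha : AnalyticOnNhd ℂ f (ball 0 1) := hf.analyticOnNhd isOpen_ball
  refine (ha.is_constant_or_isOpen (convex_ball (0:ℂ) 1).isPreconnected).resolve_left ?_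
  rintro ⟨w, hw⟩
  have h1 : (0:ℂ) ∈ ball (0:ℂ) 1 := by simp
  have h2 : (1/2:ℂ) ∈ ball (0:ℂ) 1 := by simp; norm_num
  have := hinj h1 h2 ((hw _ h1).trans (hw _ h2).symm)
  norm_num at this

lemma not_surj (f : ℂ → ℂ) (hf : DifferentiableOn ℂ f (ball 0 1))
    (hinj : InjOn f (ball 0 1)) (ζ : ℂ) (hζ : ζ ∈ ball (0:ℂ) 1) (h1 : deriv f ζ ≠ 0) :
    f '' ball 0 1 ≠ univ := by
  intro hsurj
  set g := Function.invFunOn f (ball (0:ℂ) 1) with hg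
  have hsj : ∀ w, ∃ z ∈ ball (0:ℂ) 1, f z = w := fun w => by
    have : w ∈ f '' ball 0 1 := by rw [hsurj]; trivial
    exact this
  have hgm : ∀ w, g w ∈ ball (0:ℂ) 1 := fun w => Function.invFunOn_mem (hsj w)
  have hfg : ∀ w, f (g w) = w := fun w => Function.invFunOn_eq (hsj w)
  have hgf : ∀ z ∈ ball (0:ℂ) 1, g (f z) = z := fun z hz => hinj (hgm _) hz (hfg _)
  have hgc : Continuous g := by
    refine continuous_def.2 fun s hs => ?_
    have : g ⁻¹' s = f '' (s ∩ ball 0 1) := by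
      ext w
      constructor
      · intro hw; exact ⟨g w, ⟨hw, hgm w⟩, hfg w⟩
      · rintro ⟨z, ⟨hz, hzb⟩, rfl⟩
        simpa [hgf z hzb] using hz
    rw [this]
    exact image_open f hf hinj _ inter_subset_right (hs.inter isOpen_ball)
  set q : ℂ → ℂ := fun z => (dslope f ζ z)⁻¹ with hq
  have hmul : ∀ z, (z - ζ) * dslope f ζ z = f z - f ζ := fun z => sub_smul_dslope f ζ z
  have hqd : DifferentiableOn ℂ q (ball 0 1) := by
    apply ((differentiableOn_dslope (isOpen_ball.mem_nhds hζ)).2 hf).inv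
    intro z hz h
    by_cases hzz : z = ζ
    · rw [hzz, dslope_same] at h; exact h1 h
    · apply hzz
      apply hinj hz hζ
      have := hmul z
      rw [h, mul_zero] at this
      exact (sub_eq_zero.1 this.symm)
  have hqζ : 0 < ‖q ζ‖ := by simp [hq, h1]
  set M := 4 / ‖q ζ‖ with hM
  have hMpos : 0 < M := by positivity
  have hK : IsCompact (g '' closedBall (f ζ) M) := (isCompact_closedBall _ _).image hgc
  obtain ⟨x, hx, hmax⟩ := hK.exists_isMaxOn ((nonempty_closedBall.2 hMpos.le).image g)
    continuous_norm.continuousOn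
  obtain ⟨y, -, rfl⟩ := hx
  have hy := hgm y
  simp only [mem_ball_zero_iff] at hy hζ
  obtain ⟨r, hr, hr1⟩ := exists_between (max_lt hy hζ)
  have hr0 : 0 < r := (norm_nonneg _).trans_lt ((le_max_left _ _).trans_lt hr)
  have hdc : DiffContOnCl ℂ q (ball 0 r) := DifferentiableOn.diffContOnCl (by
    rw [closure_ball _ hr0.ne']; exact hqd.mono (closedBall_subset_ball hr1))
  have hbd : ∀ z ∈ frontier (ball (0:ℂ) r), ‖q z‖ ≤ 2 / M := by
    intro z hz
    rw [frontier_ball _ hr0.ne', mem_sphere_zero_iff_norm] at hz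
    have hzb : z ∈ ball (0:ℂ) 1 := by simpa [hz] using hr1
    have hfz : M < ‖f z - f ζ‖ := by
      by_contra! hcon
      have : z ∈ g '' closedBall (f ζ) M :=
        ⟨f z, by simpa [dist_eq_norm] using hcon, hgf z hzb⟩
      have h5 : ‖z‖ ≤ ‖g y‖ := hmax this
      have := (le_max_left _ _).trans_lt hr
      linarith
    have hmz := hmul z
    have hne : f z - f ζ ≠ 0 := norm_pos_iff.1 (hMpos.trans hfz)
    have hqz : q z = (z - ζ) / (f z - f ζ) := by
      rw [← hmz] at hne ⊢
      have n1 := left_ne_zero_of_mul hne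
      have n2 := right_ne_zero_of_mul hne
      simp only [hq]; field_simp
    rw [hqz, norm_div]
    have : ‖z - ζ‖ ≤ 2 := (norm_sub_le _ _).trans (by linarith)
    gcongr
  have := Complex.norm_le_of_forall_mem_frontier_norm_le isBounded_ball hdc hbd (z := ζ)
    (subset_closure (by simpa using (le_max_right _ _).trans_lt hr))
  have e : 2 / M = ‖q ζ‖ / 2 := by rw [hM]; field_simp; norm_num
  linarith


/-- Standard Koebe-type estimates for a univalent map `f` of the unit disk:
`|((1-|ζ|²)/2)(f''/f')(ζ) - ζ̄| ≤ 2` and `(1-|ζ|²)|f'(ζ)| ≤ 4 dist(f(ζ), ∂f(𝔻))`. -/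
theorem univalent_preschwarzian_and_distance_bounds
    (f : ℂ → ℂ)
    (hf : DifferentiableOn ℂ f (ball (0:ℂ) 1))
    (hinj : InjOn f (ball (0:ℂ) 1)) :
    ∀ ζ ∈ ball (0:ℂ) 1,
      ‖(((1 - ‖ζ‖ ^ 2) / 2 : ℝ) : ℂ) * (deriv (deriv f) ζ / deriv f ζ) -
          (starRingEnd ℂ) ζ‖ ≤ 2 ∧
      (1 - ‖ζ‖ ^ 2) * ‖deriv f ζ‖ ≤ 4 * infDist (f ζ) (frontier (f '' ball (0:ℂ) 1)) := by
  intro ζ hζ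
  have hζ1 : ‖ζ‖ < 1 := by simpa using hζ
  by_cases h1 : deriv f ζ = 0
  · rw [h1]
    simp only [div_zero, mul_zero, zero_sub, norm_neg, RCLike.norm_conj, norm_zero]
    exact ⟨by linarith, mul_nonneg (by norm_num) infDist_nonneg⟩
  set c := (starRingEnd ℂ) ζ with hc
  have hcn : ‖c‖ < 1 := by rw [hc, RCLike.norm_conj]; exact hζ1
  have hcz : c * ζ = (‖ζ‖:ℂ) ^ 2 := by
    rw [hc, mul_comm, mul_conj, normSq_eq_norm_sq]; simp
  have hpos : 0 < 1 - ‖ζ‖ ^ 2 := by nlinarith [norm_nonneg ζ]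
  obtain ⟨k, hk⟩ : ∃ k : ℂ, k = ((1 - ‖ζ‖ ^ 2 : ℝ) : ℂ) := ⟨_, rfl⟩
  have hk' : k = 1 - c * ζ := by rw [hk, hcz]; push_cast; ring
  have hk0 : k ≠ 0 := by rw [hk]; exact_mod_cast hpos.ne'
  have hden : ∀ z ∈ ball (0:ℂ) 1, 1 + c * z ≠ 0 := by
    intro z hz h
    have hz : ‖z‖ < 1 := by simpa using hz
    have : c * z = -1 := by linear_combination h
    have h2 := congrArg norm this
    rw [norm_mul, norm_neg, norm_one] at h2
    nlinarith [norm_nonneg c, norm_nonneg z]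
  set φ : ℂ → ℂ := fun z => (z + ζ) / (1 + c * z) with hφ
  have hφm : ∀ z ∈ ball (0:ℂ) 1, φ z ∈ ball (0:ℂ) 1 := by
    intro z hz
    have hd := hden z hz
    have hz : ‖z‖ < 1 := by simpa using hz
    simp only [hφ, mem_ball_zero_iff, norm_div]
    rw [div_lt_one (norm_pos_iff.2 hd)]
    apply lt_of_pow_lt_pow_left₀ 2 (norm_nonneg _)
    have e : ‖1 + c * z‖ ^ 2 - ‖z + ζ‖ ^ 2 = (1 - ‖z‖ ^ 2) * (1 - ‖ζ‖ ^ 2) := by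
      simp only [Complex.sq_norm, normSq_apply, hc, add_re, add_im, mul_re, mul_im, conj_re,
        conj_im, one_re, one_im]
      ring
    have : 0 < (1 - ‖z‖ ^ 2) := by nlinarith [norm_nonneg z]
    have := mul_pos this hpos
    linarith
  have hφd : ∀ z ∈ ball (0:ℂ) 1, HasDerivAt φ (k * ((1 + c * z)⁻¹) ^ 2) z := by
    intro z hz
    have hd := hden z hz
    have h := ((hasDerivAt_id z).add_const ζ).div
      (((hasDerivAt_id z).const_mul c).const_add 1) hd
    convert! h using 1
    rw [hk']
    simp only [id]
    field_simp
    ring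
  have hφi : InjOn φ (ball 0 1) := by
    intro z hz w hw h
    have n1 := hden z hz
    have n2 := hden w hw
    simp only [hφ] at h
    rw [div_eq_div_iff n1 n2] at h
    have : k * (z - w) = 0 := by rw [hk']; linear_combination h
    exact sub_eq_zero.1 ((mul_eq_zero.1 this).resolve_left hk0)
  have hφ0 : φ 0 = ζ := by simp [hφ]
  set F : ℂ → ℂ := fun z => f (φ z) with hFdef
  have hFD : ∀ z ∈ ball (0:ℂ) 1, HasDerivAt F (deriv f (φ z) * (k * ((1 + c * z)⁻¹) ^ 2)) z :=
    fun z hz => HasDerivAt.comp z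
      (hf.differentiableAt (isOpen_ball.mem_nhds (hφm z hz))).hasDerivAt (hφd z hz)
  have hFd : DifferentiableOn ℂ F (ball 0 1) := fun z hz =>
    (hFD z hz).differentiableAt.differentiableWithinAt
  have hFi : InjOn F (ball 0 1) := fun z hz w hw h =>
    hφi hz hw (hinj (hφm z hz) (hφm w hw) h)
  have hm : (0:ℂ) ∈ ball (0:ℂ) 1 := by simp
  have hF1 : deriv F 0 = deriv f ζ * k := by
    rw [(hFD 0 hm).deriv, hφ0]; simp
  have hF1n : deriv F 0 ≠ 0 := by rw [hF1]; exact mul_ne_zero h1 hk0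
  have hF2 : deriv (deriv F) 0 = deriv (deriv f) ζ * k ^ 2 - 2 * c * k * deriv f ζ := by
    have he : deriv F =ᶠ[nhds 0] fun z => deriv f (φ z) * (k * ((1 + c * z)⁻¹) ^ 2) := by
      filter_upwards [isOpen_ball.mem_nhds hm] with z hz
      exact (hFD z hz).deriv
    rw [he.deriv_eq]
    have hf'' : HasDerivAt (deriv f) (deriv (deriv f) ζ) (φ 0) := by
      rw [hφ0]
      exact ((hf.deriv isOpen_ball).differentiableAt (isOpen_ball.mem_nhds hζ)).hasDerivAt
    have b1 := HasDerivAt.comp (0:ℂ) hf'' (hφd 0 hm)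
    have b2 := (((((hasDerivAt_id (0:ℂ)).const_mul c).const_add 1).inv
      (by simp)).pow 2).const_mul k
    refine (b1.mul b2).deriv.trans ?_
    simp [hφ0]
    ring
  constructor
  · have hb := bieb F hFd hFi hF1n
    rw [hF1, hF2] at hb
    have e : (((1 - ‖ζ‖ ^ 2) / 2 : ℝ) : ℂ) * (deriv (deriv f) ζ / deriv f ζ) - c =
        ((deriv (deriv f) ζ * k ^ 2 - 2 * c * k * deriv f ζ) / (deriv f ζ * k)) / 2 := by
      rw [show (((1 - ‖ζ‖ ^ 2) / 2 : ℝ) : ℂ) = k / 2 by rw [hk]; push_cast; ring]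
      field_simp
    rw [e, norm_div, Complex.norm_ofNat]
    linarith
  · have hopen : IsOpen (f '' ball 0 1) := image_open f hf hinj _ le_rfl isOpen_ball
    have hne : (frontier (f '' ball (0:ℂ) 1)).Nonempty := by
      rw [nonempty_frontier_iff]
      exact ⟨⟨f 0, mem_image_of_mem f hm⟩, not_surj f hf hinj ζ hζ h1⟩
    have hl : (1 - ‖ζ‖ ^ 2) * ‖deriv f ζ‖ / 4 ≤ infDist (f ζ) (frontier (f '' ball (0:ℂ) 1)) := by
      rw [le_infDist hne]
      intro w hw
      rw [hopen.frontier_eq] at hw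
      have hK := koebe F hFd hFi hF1n w (fun z hz h => hw.2 ⟨φ z, hφm z hz, h⟩)
      rw [hF1, norm_mul, hk, Complex.norm_of_nonneg hpos.le] at hK
      simp only [hFdef, hφ0] at hK
      rw [dist_comm, dist_eq_norm]
      linarith
    linarith
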